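/- Let a ∈ ℝ and let f : ℝ² → ℝ be twice continuously differentiable with compact support. Then lim_{δ → 0⁺} ( ∫_{ℝ²} f(y) · 8δ²(aδ² − |y|²)/(δ² + |y|²)⁴ dy − (4π/(3δ²))(2a − 1) f(0) ) = (a − 2)(π/3) Δf(0), where Δ denotes the Euclidean Laplacian Δf = ∂²f/∂y₁² + ∂²f/∂y₂². -/

import Mathlib

open MeasureTheory Real Filter

/-- Euclidean Laplacian on ℝ²: sum of second partial derivatives. -/
noncomputable def lap (f : EuclideanSpace ℝ (Fin 2) → ℝ) (x : EuclideanSpace ℝ (Fin 2)) : ℝ :=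
  ∑ i : Fin 2,
    fderiv ℝ (fun y => fderiv ℝ f y (EuclideanSpace.single i (1 : ℝ))) x
      (EuclideanSpace.single i (1 : ℝ))

local notation "𝔼" => EuclideanSpace ℝ (Fin 2)

/-- The profile obtained by rescaling the kernel to `δ = 1`. -/
noncomputable def weight (a : ℝ) (z : 𝔼) : ℝ :=
  8 * (a - ‖z‖ ^ 2) / (1 + ‖z‖ ^ 2) ^ 4

theorem continuous_weight (a : ℝ) : Continuous (weight a) := by
  unfold weight
  exact Continuous.div (by fun_prop) (by fun_prop) (fun z => by positivity)

theorem integrable_inv_one_add_norm_sq_pow (n : ℕ) :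
    Integrable (fun z : 𝔼 => ((1 + ‖z‖ ^ 2) ^ (n + 2))⁻¹) := by
  have h := integrable_rpow_neg_one_add_norm_sq (E := 𝔼) (μ := volume)
    (r := 2 * ((n + 2 : ℕ) : ℝ)) (by
      rw [finrank_euclideanSpace_fin]; push_cast
      have : (0 : ℝ) ≤ n := n.cast_nonneg
      linarith)
  refine h.congr (Eventually.of_forall fun z => ?_)
  have hz : (0 : ℝ) ≤ 1 + ‖z‖ ^ 2 := by positivity
  have h2 : -(2 * ((n + 2 : ℕ) : ℝ)) / 2 = -((n + 2 : ℕ) : ℝ) := by ring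
  simp only [h2]
  rw [Real.rpow_neg hz, Real.rpow_natCast]

theorem integral_inv_one_add_norm_sq_pow (n : ℕ) :
    ∫ z : 𝔼, ((1 + ‖z‖ ^ 2) ^ (n + 2))⁻¹ = π / (n + 1) := by
  have hvol : (volume : Measure 𝔼).real (Metric.ball 0 1) = π := by
    rw [Measure.real, EuclideanSpace.volume_ball_fin_two]
    simp [Real.pi_pos.le]
  have hradial : ∫ y in Set.Ioi (0 : ℝ), y * ((1 + y ^ 2) ^ (n + 2))⁻¹ =
      0 - (-(1 / (2 * (n + 1 : ℝ))) * ((1 + (0 : ℝ) ^ 2) ^ (n + 1))⁻¹) := by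
    refine integral_Ioi_of_hasDerivAt_of_nonneg'
      (g := fun y : ℝ => -(1 / (2 * (n + 1 : ℝ))) * ((1 + y ^ 2) ^ (n + 1))⁻¹)
      (fun y _ => ?_) (fun y hy => ?_) ?_
    · have hne : (1 + y ^ 2) ≠ 0 := by positivity
      have h1 : HasDerivAt (fun y : ℝ => 1 + y ^ 2) (2 * y) y := by
        simpa using (hasDerivAt_pow 2 y).const_add 1
      refine (((h1.pow (n + 1)).inv (pow_ne_zero _ hne)).const_mul
        (-(1 / (2 * (n + 1 : ℝ))))).congr_deriv ?_
      have hn : (n + 1 : ℝ) ≠ 0 := by positivity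
      simp only [Nat.add_sub_cancel, Pi.pow_apply]
      push_cast
      field_simp
      ring
    · have : (0 : ℝ) < y := hy
      positivity
    · have h1 : Tendsto (fun y : ℝ => (1 + y ^ 2) ^ (n + 1)) atTop atTop :=
        (tendsto_pow_atTop (Nat.succ_ne_zero n)).comp
          (tendsto_atTop_add_const_left _ 1 (tendsto_pow_atTop two_ne_zero))
      simpa using h1.inv_tendsto_atTop.const_mul (-(1 / (2 * (n + 1 : ℝ))))
  rw [integral_fun_norm_addHaar volume (fun r : ℝ => ((1 + r ^ 2) ^ (n + 2))⁻¹), hvol,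
    finrank_euclideanSpace_fin]
  simp only [Nat.add_one_sub_one, pow_one, smul_eq_mul, nsmul_eq_mul]
  rw [hradial]
  have hn : (n + 1 : ℝ) ≠ 0 := by positivity
  simp
  field_simp

theorem weight_eq (a : ℝ) (z : 𝔼) :
    weight a z = 8 * (a + 1) * ((1 + ‖z‖ ^ 2) ^ (2 + 2))⁻¹
      - 8 * ((1 + ‖z‖ ^ 2) ^ (1 + 2))⁻¹ := by
  have : (1 + ‖z‖ ^ 2) ≠ 0 := by positivity
  unfold weight
  field_simp
  ring

theorem norm_sq_mul_weight_eq (a : ℝ) (z : 𝔼) :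
    ‖z‖ ^ 2 * weight a z = 8 * (a + 2) * ((1 + ‖z‖ ^ 2) ^ (1 + 2))⁻¹
      - 8 * (a + 1) * ((1 + ‖z‖ ^ 2) ^ (2 + 2))⁻¹ - 8 * ((1 + ‖z‖ ^ 2) ^ (0 + 2))⁻¹ := by
  have : (1 + ‖z‖ ^ 2) ≠ 0 := by positivity
  unfold weight
  field_simp
  ring

theorem integral_weight (a : ℝ) : ∫ z, weight a z = 4 * π / 3 * (2 * a - 1) := by
  have h (n : ℕ) (c : ℝ) := (integrable_inv_one_add_norm_sq_pow n).const_mul c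
  simp only [weight_eq]
  rw [integral_sub (h _ _) (h _ _)]
  simp only [integral_const_mul, integral_inv_one_add_norm_sq_pow]
  push_cast
  ring

theorem integral_norm_sq_mul_weight (a : ℝ) :
    ∫ z, ‖z‖ ^ 2 * weight a z = 4 * π / 3 * (a - 2) := by
  have h (n : ℕ) (c : ℝ) := (integrable_inv_one_add_norm_sq_pow n).const_mul c
  simp only [norm_sq_mul_weight_eq]
  rw [integral_sub ((h _ _).sub' (h _ _)) (h _ _), integral_sub (h _ _) (h _ _)]
  simp only [integral_const_mul, integral_inv_one_add_norm_sq_pow]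
  push_cast
  ring

theorem abs_weight_le (a : ℝ) (z : 𝔼) :
    |weight a z| ≤ 8 * (|a| + 1) * ((1 + ‖z‖ ^ 2) ^ 3)⁻¹ := by
  have h1 : |a - ‖z‖ ^ 2| ≤ (|a| + 1) * (1 + ‖z‖ ^ 2) := by
    refine (abs_sub _ _).trans ?_
    rw [abs_of_nonneg (sq_nonneg ‖z‖)]
    nlinarith [abs_nonneg a, sq_nonneg ‖z‖, mul_nonneg (abs_nonneg a) (sq_nonneg ‖z‖)]
  have hp : 0 < 1 + ‖z‖ ^ 2 := by positivity
  unfold weight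
  rw [abs_div, abs_mul, abs_of_pos (pow_pos hp 4), abs_of_pos (by norm_num : (0 : ℝ) < 8),
    div_le_iff₀ (pow_pos hp 4)]
  calc 8 * |a - ‖z‖ ^ 2| ≤ 8 * ((|a| + 1) * (1 + ‖z‖ ^ 2)) := by gcongr
    _ = _ := by field_simp

theorem abs_mul_weight_le {a M g : ℝ} {z : 𝔼} (hg : |g| ≤ M * (1 + ‖z‖ ^ 2)) :
    ‖g * weight a z‖ ≤ M * (8 * (|a| + 1)) * ((1 + ‖z‖ ^ 2) ^ (0 + 2))⁻¹ := by
  have hp : 0 < 1 + ‖z‖ ^ 2 := by positivity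
  rw [Real.norm_eq_abs, abs_mul]
  calc |g| * |weight a z|
      ≤ (M * (1 + ‖z‖ ^ 2)) * (8 * (|a| + 1) * ((1 + ‖z‖ ^ 2) ^ 3)⁻¹) :=
        mul_le_mul hg (abs_weight_le a z) (abs_nonneg _) ((abs_nonneg _).trans hg)
    _ = _ := by field_simp

theorem integrable_mul_weight (a M : ℝ) {g : 𝔼 → ℝ} (hc : Continuous g)
    (hg : ∀ z, |g z| ≤ M * (1 + ‖z‖ ^ 2)) : Integrable (fun z => g z * weight a z) :=
  ((integrable_inv_one_add_norm_sq_pow 0).const_mul (M * (8 * (|a| + 1)))).mono'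
    (hc.mul (continuous_weight a)).aestronglyMeasurable
    (Eventually.of_forall fun z => abs_mul_weight_le (hg z))

/-- Rotation of the plane by a right angle. -/
noncomputable def quarterTurn : 𝔼 ≃ₗᵢ[ℝ] 𝔼 where
  toFun z := !₂[-z 1, z 0]
  invFun z := !₂[z 1, -z 0]
  map_add' x y := by
    ext i; fin_cases i
    · simp [add_comm]
    · simp
  map_smul' c x := by ext i; fin_cases i <;> simp
  left_inv x := by ext i; fin_cases i <;> simp
  right_inv x := by ext i; fin_cases i <;> simp
  norm_map' x := by simp [EuclideanSpace.norm_eq, Fin.sum_univ_two, add_comm]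

theorem apply_self_add_apply_quarterTurn (B : 𝔼 →L[ℝ] 𝔼 →L[ℝ] ℝ) (z : 𝔼) :
    B z z + B (quarterTurn z) (quarterTurn z) =
      ‖z‖ ^ 2 * ∑ i : Fin 2, B (EuclideanSpace.single i 1) (EuclideanSpace.single i 1) := by
  have hz : z = z 0 • EuclideanSpace.single 0 (1 : ℝ) + z 1 • EuclideanSpace.single 1 (1 : ℝ) := by
    ext i; fin_cases i <;> simp
  have hr : quarterTurn z =
      (-z 1) • EuclideanSpace.single 0 (1 : ℝ) + z 0 • EuclideanSpace.single 1 (1 : ℝ) := by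
    ext i; fin_cases i <;> simp [quarterTurn]
  have hn : ‖z‖ ^ 2 = z 0 ^ 2 + z 1 ^ 2 := by
    simp [EuclideanSpace.norm_sq_eq, Fin.sum_univ_two]
  have hB : B z z =
      B (z 0 • EuclideanSpace.single 0 (1 : ℝ) + z 1 • EuclideanSpace.single 1 (1 : ℝ))
        (z 0 • EuclideanSpace.single 0 (1 : ℝ) + z 1 • EuclideanSpace.single 1 (1 : ℝ)) := by
    rw [← hz]
  rw [hB, hr, hn]
  simp only [map_add, map_smul, add_apply, smul_apply,
    smul_eq_mul, Fin.sum_univ_two]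
  ring

theorem abs_bilin_apply_le (B : 𝔼 →L[ℝ] 𝔼 →L[ℝ] ℝ) (z : 𝔼) :
    |B z z| ≤ ‖B‖ * (1 + ‖z‖ ^ 2) := by
  have h := B.le_opNorm₂ z z
  rw [Real.norm_eq_abs] at h
  nlinarith [norm_nonneg B]

theorem integral_bilin_mul_weight (a : ℝ) (B : 𝔼 →L[ℝ] 𝔼 →L[ℝ] ℝ) :
    ∫ z, B z z * weight a z = 2 * π / 3 * (a - 2) *
      ∑ i : Fin 2, B (EuclideanSpace.single i 1) (EuclideanSpace.single i 1) := by
  have hrot : ∫ z, B (quarterTurn z) (quarterTurn z) * weight a z = ∫ z, B z z * weight a z := by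
    rw [← quarterTurn.measurePreserving.integral_comp
      quarterTurn.toHomeomorph.measurableEmbedding (fun z => B z z * weight a z)]
    simp [weight]
  have hi : Integrable (fun z => B z z * weight a z) :=
    integrable_mul_weight a ‖B‖ (by fun_prop) (abs_bilin_apply_le B)
  have hi' : Integrable (fun z => B (quarterTurn z) (quarterTurn z) * weight a z) :=
    integrable_mul_weight a ‖B‖
      ((B.continuous.comp quarterTurn.continuous).clm_apply quarterTurn.continuous) fun z => by
        simpa using abs_bilin_apply_le B (quarterTurn z)
  have hsum := integral_add hi hi'
  simp only [← add_mul, apply_self_add_apply_quarterTurn] at hsum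
  simp only [mul_right_comm _ (∑ i : Fin 2, _) _, integral_mul_const,
    integral_norm_sq_mul_weight, hrot] at hsum
  linarith

theorem integral_linear_mul_weight (a : ℝ) (L : 𝔼 →L[ℝ] ℝ) : ∫ z, L z * weight a z = 0 := by
  have h := integral_neg_eq_self (fun z => L z * weight a z) volume
  simp only [weight, norm_neg, map_neg, neg_mul, integral_neg] at h ⊢
  linarith

/-- A quadratic Taylor bound, uniform in the point, for compactly supported `C²` functions. -/
theorem exists_taylor_bound {E : Type*} [NormedAddCommGroup E] [NormedSpace ℝ E] {f : E → ℝ}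
    (hf : ContDiff ℝ 2 f) (hsupp : HasCompactSupport f) :
    ∃ C : ℝ, 0 ≤ C ∧ ∀ y, |f y - f 0 - fderiv ℝ f 0 y| ≤ C * ‖y‖ ^ 2 := by
  obtain ⟨C, hC⟩ := ContDiff.lipschitzWith_of_hasCompactSupport (hsupp.fderiv ℝ)
    (hf.fderiv_right (m := 1) (by norm_num)) one_ne_zero
  refine ⟨C, C.2, fun y => ?_⟩
  have h := Convex.norm_image_sub_le_of_norm_fderiv_le' (𝕜 := ℝ) (f := f) (C := C * ‖y‖)
    (s := Metric.closedBall 0 ‖y‖) (x := 0) (y := y) (φ := fderiv ℝ f 0)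
    (fun x _ => (hf.differentiable two_ne_zero) x)
    (fun x hx => (hC.norm_sub_le x 0).trans (by
      rw [mem_closedBall_zero_iff] at hx
      rw [sub_zero]
      gcongr))
    (convex_closedBall _ _) (by simp) (by simp)
  rw [sub_zero, Real.norm_eq_abs] at h
  rwa [sq, ← mul_assoc]

theorem tendsto_taylor_quotient {E : Type*} [NormedAddCommGroup E] [NormedSpace ℝ E] {f : E → ℝ}
    (hf : ContDiff ℝ 2 f) (z : E) :
    Tendsto (fun δ : ℝ => (f (δ • z) - f 0 - fderiv ℝ f 0 (δ • z)) / δ ^ 2)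
      (nhdsWithin 0 (Set.Ioi 0)) (nhds (1 / 2 * fderiv ℝ (fderiv ℝ f) 0 z z)) := by
  have hline (t : ℝ) : HasDerivAt (fun δ : ℝ => δ • z) z t := by
    simpa using (hasDerivAt_id t).smul_const z
  have hdf : Differentiable ℝ f := hf.differentiable two_ne_zero
  have hd2f : Differentiable ℝ (fderiv ℝ f) :=
    (hf.fderiv_right (m := 1) (by norm_num)).differentiable one_ne_zero
  have hnum (t : ℝ) : HasDerivAt (fun δ : ℝ => f (δ • z) - f 0 - fderiv ℝ f 0 (δ • z))
      (fderiv ℝ f (t • z) z - fderiv ℝ f 0 z) t :=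
    (((hdf (t • z)).hasFDerivAt.comp_hasDerivAt t (hline t)).sub_const _).sub
      ((fderiv ℝ f 0).hasFDerivAt.comp_hasDerivAt t (hline t))
  have hden (t : ℝ) : HasDerivAt (fun δ : ℝ => δ ^ 2) (2 * t) t := by
    simpa using hasDerivAt_pow 2 t
  refine HasDerivAt.lhopital_zero_nhdsGT (Eventually.of_forall hnum) (Eventually.of_forall hden)
    ?_ ?_ ?_ ?_
  · filter_upwards [self_mem_nhdsWithin] with t ht
    exact mul_ne_zero two_ne_zero (ne_of_gt ht)
  · simpa using (hnum 0).continuousAt.tendsto.mono_left nhdsWithin_le_nhds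
  · simpa using (hden 0).continuousAt.tendsto.mono_left nhdsWithin_le_nhds
  · have h1 : HasDerivAt (fun δ : ℝ => fderiv ℝ f (δ • z) z) (fderiv ℝ (fderiv ℝ f) 0 z z) 0 := by
      have h2 : HasFDerivAt (fderiv ℝ f) (fderiv ℝ (fderiv ℝ f) 0) ((0 : ℝ) • z) := by
        rw [zero_smul]; exact (hd2f 0).hasFDerivAt
      exact (ContinuousLinearMap.apply ℝ ℝ z).hasFDerivAt.comp_hasDerivAt (0 : ℝ)
        (h2.comp_hasDerivAt (0 : ℝ) (hline 0))
    have h3 := (h1.tendsto_slope.mono_left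
      (nhdsWithin_mono (0 : ℝ) fun t (ht : 0 < t) => ht.ne')).const_mul (1 / 2)
    refine h3.congr fun t => ?_
    simp only [slope_def_field, zero_smul, sub_zero]
    ring

theorem lap_eq_sum {f : 𝔼 → ℝ} (hf : ContDiff ℝ 2 f) (x : 𝔼) :
    lap f x = ∑ i : Fin 2, fderiv ℝ (fderiv ℝ f) x (EuclideanSpace.single i 1)
      (EuclideanSpace.single i 1) := by
  have hd2f : Differentiable ℝ (fderiv ℝ f) :=
    (hf.fderiv_right (m := 1) (by norm_num)).differentiable one_ne_zero
  refine Finset.sum_congr rfl fun i _ => ?_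
  rw [fderiv_clm_apply (hd2f x) (by fun_prop)]
  simp

theorem integral_mul_kernel_eq (a : ℝ) (f : 𝔼 → ℝ) {δ : ℝ} (hδ : 0 < δ) :
    ∫ y, f y * (8 * δ ^ 2 * (a * δ ^ 2 - ‖y‖ ^ 2) / (δ ^ 2 + ‖y‖ ^ 2) ^ 4) =
      (δ ^ 2)⁻¹ * ∫ z, f (δ • z) * weight a z := by
  have h := Measure.integral_comp_smul (volume : Measure 𝔼)
    (fun y => f y * (8 * δ ^ 2 * (a * δ ^ 2 - ‖y‖ ^ 2) / (δ ^ 2 + ‖y‖ ^ 2) ^ 4)) δ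
  rw [finrank_euclideanSpace_fin, abs_of_pos (by positivity), smul_eq_mul,
    eq_inv_mul_iff_mul_eq₀ (by positivity)] at h
  rw [← h, ← integral_const_mul, ← integral_const_mul]
  refine integral_congr_ae (Eventually.of_forall fun z => ?_)
  have hp : 1 + ‖z‖ ^ 2 ≠ 0 := by positivity
  have hq : δ ^ 2 + (δ * ‖z‖) ^ 2 = δ ^ 2 * (1 + ‖z‖ ^ 2) := by ring
  simp only [norm_smul, Real.norm_eq_abs, abs_of_pos hδ, weight, hq]
  field_simp

theorem integral_kernel_sub_eq (a : ℝ) {f : 𝔼 → ℝ} (hc : Continuous f)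
    (hsupp : HasCompactSupport f) (L : 𝔼 →L[ℝ] ℝ) {δ : ℝ} (hδ : 0 < δ) :
    (∫ y, f y * (8 * δ ^ 2 * (a * δ ^ 2 - ‖y‖ ^ 2) / (δ ^ 2 + ‖y‖ ^ 2) ^ 4)) -
        4 * π / (3 * δ ^ 2) * (2 * a - 1) * f 0 =
      ∫ z, (f (δ • z) - f 0 - L (δ • z)) / δ ^ 2 * weight a z := by
  obtain ⟨M, hM⟩ := hsupp.exists_bound_of_continuous hc
  have hM0 : 0 ≤ M := (norm_nonneg _).trans (hM 0)
  have hi : Integrable (fun z => f (δ • z) * weight a z) :=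
    integrable_mul_weight a M (by fun_prop) fun z =>
      (hM _).trans (le_mul_of_one_le_right hM0 (by nlinarith [sq_nonneg ‖z‖]))
  have hi0 : Integrable (fun z => f 0 * weight a z) :=
    integrable_mul_weight a M (by fun_prop) fun z =>
      (hM _).trans (le_mul_of_one_le_right hM0 (by nlinarith [sq_nonneg ‖z‖]))
  have hi1 : Integrable (fun z => (δ • L) z * weight a z) :=
    integrable_mul_weight a ‖δ • L‖ (by fun_prop) fun z =>
      ((δ • L).le_opNorm z).trans (by
        gcongr
        nlinarith [sq_nonneg (‖z‖ - 1), sq_nonneg ‖z‖])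
  have hsplit (z : 𝔼) : (f (δ • z) - f 0 - L (δ • z)) / δ ^ 2 * weight a z =
      (δ ^ 2)⁻¹ * (f (δ • z) * weight a z - f 0 * weight a z - (δ • L) z * weight a z) := by
    simp only [map_smul, smul_apply, smul_eq_mul]
    ring
  simp only [hsplit]
  rw [integral_const_mul, integral_sub (hi.sub' hi0) hi1, integral_sub hi hi0,
    integral_linear_mul_weight, integral_const_mul, integral_weight,
    integral_mul_kernel_eq a f hδ]
  field_simp
  ring

theorem second_order_expansion_general (a : ℝ) (f : EuclideanSpace ℝ (Fin 2) → ℝ)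
    (hf : ContDiff ℝ 2 f) (hsupp : HasCompactSupport f) :
    Tendsto (fun δ : ℝ =>
        (∫ y : EuclideanSpace ℝ (Fin 2),
            f y * (8 * δ ^ 2 * (a * δ ^ 2 - ‖y‖ ^ 2) / (δ ^ 2 + ‖y‖ ^ 2) ^ 4)) -
          4 * π / (3 * δ ^ 2) * (2 * a - 1) * f 0)
      (nhdsWithin 0 (Set.Ioi 0)) (nhds ((a - 2) * (π / 3) * lap f 0)) := by
  obtain ⟨C, hC0, hC⟩ := exists_taylor_bound hf hsupp
  have hlim : (a - 2) * (π / 3) * lap f 0 =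
      ∫ z, 1 / 2 * fderiv ℝ (fderiv ℝ f) 0 z z * weight a z := by
    simp only [mul_assoc (1 / 2 : ℝ)]
    rw [integral_const_mul, integral_bilin_mul_weight, lap_eq_sum hf]
    ring
  rw [hlim]
  refine Tendsto.congr' (f₁ := fun δ : ℝ => ∫ z : EuclideanSpace ℝ (Fin 2),
      (f (δ • z) - f 0 - fderiv ℝ f 0 (δ • z)) / δ ^ 2 * weight a z) ?_ ?_
  · filter_upwards [self_mem_nhdsWithin] with δ hδ
    exact (integral_kernel_sub_eq a hf.continuous hsupp _ hδ).symm
  refine tendsto_integral_filter_of_dominated_convergence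
    (fun z => C * (8 * (|a| + 1)) * ((1 + ‖z‖ ^ 2) ^ (0 + 2))⁻¹) ?_ ?_
    ((integrable_inv_one_add_norm_sq_pow 0).const_mul _) ?_
  · refine Eventually.of_forall fun δ => Continuous.aestronglyMeasurable ?_
    have := hf.continuous
    have := continuous_weight a
    fun_prop
  · filter_upwards [self_mem_nhdsWithin] with δ (hδ : 0 < δ)
    refine Eventually.of_forall fun z => abs_mul_weight_le ?_
    rw [abs_div, abs_of_pos (pow_pos hδ 2), div_le_iff₀ (pow_pos hδ 2)]
    refine (hC _).trans ?_
    rw [norm_smul, Real.norm_eq_abs, abs_of_pos hδ]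
    nlinarith [mul_nonneg hC0 (sq_nonneg δ)]
  · exact Eventually.of_forall fun z => (tendsto_taylor_quotient hf z).mul_const _
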